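/- arXiv:1503.06679 — 6 statements merged into one kernel-verified Lean document; each statement's English description precedes it below -/
import Mathlib

section
/- Let A ∈ ℝ^{m×n}, X ∈ ℝ^{n×r}, Y ∈ ℝ^{m×r} satisfy AX = Y, where X has exactly k nonzero rows and the columns of Y are linearly independent (so rank Y = r and r ≤ k). Assume that every vector x ∈ ℝ^n with at most 2k−r+1 nonzero entries satisfying Ax = 0 is the zero vector. Let Q ∈ ℝ^{m×s} be a matrix such that the kernel of the linear map v ↦ Qᵀv equals the column space of Y. Then for every index set I ⊆ {1,…,n} with |I| ≥ k one has rank(Qᵀ A_I) ≥ k − r, and equality holds for I = supp X; that is, min over all I with |I| ≥ k of rank(Qᵀ A_I) equals k − r. -/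
open Matrix

open Classical in
/-- The set of indices of nonzero rows of a matrix. -/
noncomputable def rowSupp {n N : ℕ} (X : Matrix (Fin n) (Fin N) ℝ) : Finset (Fin n) :=
  Finset.univ.filter (fun i => X i ≠ 0)

open Classical in
/-- The set of indices of nonzero entries of a vector. -/
noncomputable def vecSupp {n : ℕ} (x : Fin n → ℝ) : Finset (Fin n) :=
  Finset.univ.filter (fun i => x i ≠ 0)

/-- The rank of `Qᵀ A_I`, where `A_I` is the column submatrix of `A` indexed by `I`. -/
noncomputable def subRank {m n s : ℕ} (Q : Matrix (Fin m) (Fin s) ℝ)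
    (A : Matrix (Fin m) (Fin n) ℝ) (I : Finset (Fin n)) : ℕ :=
  ((Q.transpose * A).submatrix id (fun j : I => (j : Fin n))).rank

theorem mulVec_eq_submatrix_mulVec {m n : ℕ} {R : Type*} [NonUnitalNonAssocSemiring R]
    (A : Matrix (Fin m) (Fin n) R)
    (J : Finset (Fin n)) (x : Fin n → R) (hx : ∀ i ∉ J, x i = 0) :
    A *ᵥ x = A.submatrix id (fun j : J => (j : Fin n)) *ᵥ (fun j : J => x j) := by
  ext i
  simp only [mulVec, dotProduct, submatrix_apply, id_eq]
  rw [Finset.sum_coe_sort J (fun j => A i j * x j)]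
  exact (Finset.sum_subset (Finset.subset_univ J) fun j _ hj => by simp [hx j hj]).symm

/-- If the only `t`-sparse vector in the kernel of `A` is zero, then any at most `t` columns of `A`
form an injective matrix. -/
theorem submatrix_mulVecLin_injective {m n t : ℕ} (A : Matrix (Fin m) (Fin n) ℝ)
    (hA : ∀ x : Fin n → ℝ, (vecSupp x).card ≤ t → A *ᵥ x = 0 → x = 0)
    (J : Finset (Fin n)) (hJ : J.card ≤ t) :
    Function.Injective (A.submatrix id (fun j : J => (j : Fin n))).mulVecLin := by
  rw [← LinearMap.ker_eq_bot, LinearMap.ker_eq_bot']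
  intro v hv
  let x : Fin n → ℝ := fun i => if h : i ∈ J then v ⟨i, h⟩ else 0
  have hx : ∀ i ∉ J, x i = 0 := fun i hi => dif_neg hi
  have hxv : (fun j : J => x j) = v := by
    ext j
    simp [x]
  have hsupp : vecSupp x ⊆ J := fun i hi => by
    by_contra h
    exact (Finset.mem_filter.mp hi).2 (hx i h)
  have hx0 : x = 0 := by
    refine hA x ((Finset.card_le_card hsupp).trans hJ) ?_
    rw [mulVec_eq_submatrix_mulVec A J x hx, hxv]
    exact hv
  rw [← hxv, hx0]
  rfl

theorem subRank_mono {m n s : ℕ} (Q : Matrix (Fin m) (Fin s) ℝ) (A : Matrix (Fin m) (Fin n) ℝ)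
    {J I : Finset (Fin n)} (h : J ⊆ I) : subRank Q A J ≤ subRank Q A I := by
  unfold subRank
  rw [rank_eq_finrank_span_cols, rank_eq_finrank_span_cols]
  apply Submodule.finrank_mono
  apply Submodule.span_mono
  rintro _ ⟨j, rfl⟩
  exact ⟨⟨j, h j.2⟩, rfl⟩

theorem subRank_add_finrank_comap {m n r s : ℕ} (A : Matrix (Fin m) (Fin n) ℝ)
    (Y : Matrix (Fin m) (Fin r) ℝ) (Q : Matrix (Fin m) (Fin s) ℝ)
    (hQ : LinearMap.ker Q.transpose.mulVecLin = LinearMap.range Y.mulVecLin)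
    (J : Finset (Fin n)) :
    subRank Q A J + Module.finrank ℝ ((LinearMap.range Y.mulVecLin).comap
      (A.submatrix id (fun j : J => (j : Fin n))).mulVecLin) = J.card := by
  have h : (Q.transpose * A).submatrix id (fun j : J => (j : Fin n)) =
      Q.transpose * A.submatrix id (fun j : J => (j : Fin n)) := rfl
  rw [subRank, h, rank, ← hQ, ← LinearMap.ker_comp, ← mulVecLin_mul,
    LinearMap.finrank_range_add_finrank_ker]
  simp

theorem stmt0 {m n r s k : ℕ}
    (A : Matrix (Fin m) (Fin n) ℝ) (X : Matrix (Fin n) (Fin r) ℝ)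
    (Y : Matrix (Fin m) (Fin r) ℝ) (Q : Matrix (Fin m) (Fin s) ℝ)
    (hAX : A * X = Y)
    (hk : (rowSupp X).card = k)
    (hY : LinearIndependent ℝ (fun j : Fin r => Y.transpose j))
    (hRIP : ∀ x : Fin n → ℝ, (vecSupp x).card ≤ 2 * k - r + 1 → A.mulVec x = 0 → x = 0)
    (hQ : LinearMap.ker Q.transpose.mulVecLin = LinearMap.range Y.mulVecLin) :
    (∀ I : Finset (Fin n), k ≤ I.card → k - r ≤ subRank Q A I) ∧
      subRank Q A (rowSupp X) = k - r := by
  have hYinj : Function.Injective Y.mulVecLin := mulVec_injective_iff.mpr hY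
  have hYr : Module.finrank ℝ (LinearMap.range Y.mulVecLin) = r := by
    rw [LinearMap.finrank_range_of_inj hYinj]
    simp
  set S := rowSupp X with hS
  let XS : Matrix S (Fin r) ℝ := X.submatrix (fun j : S => (j : Fin n)) id
  have hAXS (w : Fin r → ℝ) :
      (A.submatrix id (fun j : S => (j : Fin n))).mulVecLin (XS.mulVecLin w) =
        Y.mulVecLin w := by
    have hXw : ∀ i ∉ S, (X *ᵥ w) i = 0 := by
      intro i hi
      have hXi : X i = 0 := by simpa [hS, rowSupp] using hi
      simp [mulVec, hXi]
    have hAw := mulVec_eq_submatrix_mulVec A S (X *ᵥ w) hXw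
    rw [mulVec_mulVec, hAX] at hAw
    exact hAw.symm
  have hXinj : Function.Injective XS.mulVecLin := by
    intro v w hvw
    apply hYinj
    rw [← hAXS, ← hAXS, hvw]
  have hrk : r ≤ k := by
    simpa [hk] using LinearMap.finrank_le_finrank_of_injective hXinj
  have lower (J : Finset (Fin n)) (hJ : J.card = k) : k - r ≤ subRank Q A J := by
    have hinj := submatrix_mulVecLin_injective A hRIP J (by omega)
    have hsum := subRank_add_finrank_comap A Y Q hQ J
    have hle := Submodule.finrank_mono (Submodule.map_comap_le
      (A.submatrix id (fun j : J => (j : Fin n))).mulVecLin (LinearMap.range Y.mulVecLin))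
    rw [← (Submodule.equivMapOfInjective _ hinj _).finrank_eq, hYr] at hle
    omega
  refine ⟨fun I hI => ?_, le_antisymm ?_ (lower S hk)⟩
  · obtain ⟨J, hJI, hJ⟩ := Finset.exists_subset_card_eq hI
    exact (lower J hJ).trans (subRank_mono Q A hJI)
  · have hsum := subRank_add_finrank_comap A Y Q hQ S
    have hle : LinearMap.range XS.mulVecLin ≤ (LinearMap.range Y.mulVecLin).comap
        (A.submatrix id (fun j : S => (j : Fin n))).mulVecLin := by
      rintro _ ⟨w, rfl⟩
      exact ⟨w, (hAXS w).symm⟩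
    have hfin := Submodule.finrank_mono hle
    rw [LinearMap.finrank_range_of_inj hXinj, Module.finrank_fin_fun] at hfin
    omega
end

section
/- Let A ∈ ℝ^{m×n}, X ∈ ℝ^{n×r}, Y ∈ ℝ^{m×r} satisfy AX = Y, where X has exactly k nonzero rows and the columns of Y are linearly independent (so rank Y = r and r ≤ k). Assume that every vector x ∈ ℝ^n with at most 2k−r+1 nonzero entries satisfying Ax = 0 is the zero vector. Let Q ∈ ℝ^{m×s} be a matrix such that the kernel of the linear map v ↦ Qᵀv equals the column space of Y. If an index set I ⊆ {1,…,n} satisfies |I| ≥ k and rank(Qᵀ A_I) = k − r, then I = supp X. In particular, supp X is the unique minimizer of I ↦ rank(Qᵀ A_I) over all index sets I with |I| ≥ k. -/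
open Matrix

/-- The span of the columns of `A` indexed by `I`. -/
noncomputable def colSpan {m n : ℕ} (A : Matrix (Fin m) (Fin n) ℝ) (I : Finset (Fin n)) :
    Submodule ℝ (Fin m → ℝ) :=
  LinearMap.range (A.submatrix id (fun j : I => (j : Fin n))).mulVecLin

lemma submatrix_mulVec_restrict {m n : ℕ} (A : Matrix (Fin m) (Fin n) ℝ) {I : Finset (Fin n)}
    {x : Fin n → ℝ} (hx : ∀ i ∉ I, x i = 0) :
    (A.submatrix id (fun j : I => (j : Fin n))) *ᵥ (fun j : I => x j) = A *ᵥ x := by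
  ext a
  simp only [Matrix.mulVec, dotProduct, Matrix.submatrix_apply, id]
  rw [Finset.sum_coe_sort I (fun j => A a j * x j)]
  exact Finset.sum_subset (Finset.subset_univ I) fun i _ hi => by simp [hx i hi]

lemma exists_eq_restrict {n : ℕ} {I : Finset (Fin n)} (y : I → ℝ) :
    ∃ x : Fin n → ℝ, (∀ i ∉ I, x i = 0) ∧ y = fun j : I => x j :=
  ⟨fun i => if h : i ∈ I then y ⟨i, h⟩ else 0, fun i hi => by simp [hi], by ext j; simp⟩

lemma mem_colSpan {m n : ℕ} {A : Matrix (Fin m) (Fin n) ℝ} {I : Finset (Fin n)}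
    {v : Fin m → ℝ} :
    v ∈ colSpan A I ↔ ∃ x : Fin n → ℝ, (∀ i ∉ I, x i = 0) ∧ A *ᵥ x = v := by
  constructor
  · rintro ⟨y, rfl⟩
    obtain ⟨x, hx, rfl⟩ := exists_eq_restrict y
    exact ⟨x, hx, (submatrix_mulVec_restrict A hx).symm⟩
  · rintro ⟨x, hx, rfl⟩
    exact ⟨fun j => x j, submatrix_mulVec_restrict A hx⟩

lemma colSpan_mono {m n : ℕ} (A : Matrix (Fin m) (Fin n) ℝ) {I J : Finset (Fin n)}
    (h : I ⊆ J) : colSpan A I ≤ colSpan A J := by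
  intro v hv
  obtain ⟨x, hx, rfl⟩ := mem_colSpan.1 hv
  exact mem_colSpan.2 ⟨x, fun i hi => hx i fun h' => hi (h h'), rfl⟩

lemma colSpan_union {m n : ℕ} (A : Matrix (Fin m) (Fin n) ℝ) (I J : Finset (Fin n)) :
    colSpan A (I ∪ J) = colSpan A I ⊔ colSpan A J := by
  refine le_antisymm (fun v hv => ?_) (sup_le (colSpan_mono A Finset.subset_union_left)
    (colSpan_mono A Finset.subset_union_right))
  obtain ⟨x, hx, rfl⟩ := mem_colSpan.1 hv
  have hsplit : x = (fun i => if i ∈ I then x i else 0) + fun i => if i ∈ I then 0 else x i := by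
    ext i
    by_cases hi : i ∈ I <;> simp [hi]
  rw [hsplit, Matrix.mulVec_add]
  refine Submodule.add_mem_sup (mem_colSpan.2 ⟨_, fun i hi => by simp [hi], rfl⟩)
    (mem_colSpan.2 ⟨_, fun i hi => ?_, rfl⟩)
  by_cases hI : i ∈ I
  · simp [hI]
  · simp [hI, hx i (by simp [hI, hi])]

lemma finrank_colSpan_le {m n : ℕ} (A : Matrix (Fin m) (Fin n) ℝ) (I : Finset (Fin n)) :
    Module.finrank ℝ (colSpan A I) ≤ I.card :=
  (LinearMap.finrank_range_le _).trans_eq (by simp)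

lemma vecSupp_subset {n : ℕ} {x : Fin n → ℝ} {I : Finset (Fin n)} (hx : ∀ i ∉ I, x i = 0) :
    vecSupp x ⊆ I := fun i hi => by
  by_contra h
  exact (Finset.mem_filter.1 hi).2 (hx i h)

lemma finrank_colSpan_eq {m n t : ℕ} {A : Matrix (Fin m) (Fin n) ℝ}
    (hA : ∀ x : Fin n → ℝ, (vecSupp x).card ≤ t → A.mulVec x = 0 → x = 0)
    {I : Finset (Fin n)} (hI : I.card ≤ t) : Module.finrank ℝ (colSpan A I) = I.card := by
  have hinj : Function.Injective (A.submatrix id (fun j : I => (j : Fin n))).mulVecLin := by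
    rw [← LinearMap.ker_eq_bot, LinearMap.ker_eq_bot']
    intro y hy
    obtain ⟨x, hx, rfl⟩ := exists_eq_restrict y
    rw [Matrix.mulVecLin_apply, submatrix_mulVec_restrict A hx] at hy
    rw [hA x ((Finset.card_le_card (vecSupp_subset hx)).trans hI) hy]
    rfl
  exact (LinearMap.finrank_range_of_inj hinj).trans (by simp)

lemma card_le_of_finrank_colSpan_lt {m n t : ℕ} {A : Matrix (Fin m) (Fin n) ℝ}
    (hA : ∀ x : Fin n → ℝ, (vecSupp x).card ≤ t → A.mulVec x = 0 → x = 0)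
    {I : Finset (Fin n)} (hI : Module.finrank ℝ (colSpan A I) < t) : I.card ≤ t := by
  by_contra! h
  obtain ⟨J, hJI, hJ⟩ := Finset.exists_subset_card_eq h.le
  have h₁ := finrank_colSpan_eq hA hJ.le
  have h₂ := Submodule.finrank_mono (colSpan_mono A hJI)
  omega

lemma subRank_eq {m n s : ℕ} (Q : Matrix (Fin m) (Fin s) ℝ) (A : Matrix (Fin m) (Fin n) ℝ)
    (I : Finset (Fin n)) :
    subRank Q A I = Module.finrank ℝ ((colSpan A I).map Q.transpose.mulVecLin) := by
  have h : (Q.transpose * A).submatrix id (fun j : I => (j : Fin n)) =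
      Q.transpose * A.submatrix id (fun j : I => (j : Fin n)) := rfl
  rw [subRank, h, Matrix.rank, Matrix.mulVecLin_mul, LinearMap.range_comp, colSpan]

lemma finrank_map_add_finrank_ker_eq_sup {V W : Type*} [AddCommGroup V] [Module ℝ V]
    [FiniteDimensional ℝ V] [AddCommGroup W] [Module ℝ W] (f : V →ₗ[ℝ] W) (U : Submodule ℝ V) :
    Module.finrank ℝ (U.map f) + Module.finrank ℝ (LinearMap.ker f) =
      Module.finrank ℝ (U ⊔ LinearMap.ker f : Submodule ℝ V) := by
  have h₁ := (f.domRestrict U).finrank_range_add_finrank_ker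
  have h₂ := Submodule.finrank_sup_add_finrank_inf_eq U (LinearMap.ker f)
  have h₃ : Module.finrank ℝ (LinearMap.ker (f.domRestrict U)) =
      Module.finrank ℝ (U ⊓ LinearMap.ker f : Submodule ℝ V) := by
    rw [LinearMap.ker_domRestrict, ← Submodule.map_comap_subtype]
    exact (Submodule.equivMapOfInjective _ U.injective_subtype _).finrank_eq
  rw [LinearMap.range_domRestrict] at h₁
  omega

lemma apply_eq_zero_of_notMem_rowSupp {n r : ℕ} {X : Matrix (Fin n) (Fin r) ℝ} {i : Fin n}
    (hi : i ∉ rowSupp X) : X i = 0 := by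
  by_contra h
  exact hi (by simp [rowSupp, h])

lemma range_mul_le_colSpan_rowSupp {m n r : ℕ} (A : Matrix (Fin m) (Fin n) ℝ)
    (X : Matrix (Fin n) (Fin r) ℝ) :
    LinearMap.range (A * X).mulVecLin ≤ colSpan A (rowSupp X) := by
  rintro _ ⟨c, rfl⟩
  refine mem_colSpan.2 ⟨X *ᵥ c, fun i hi => ?_, by simp⟩
  simp [Matrix.mulVec, apply_eq_zero_of_notMem_rowSupp hi]

lemma rowSupp_subset_of_range_mul_le {m n r t : ℕ} {A : Matrix (Fin m) (Fin n) ℝ}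
    {X : Matrix (Fin n) (Fin r) ℝ}
    (hA : ∀ x : Fin n → ℝ, (vecSupp x).card ≤ t → A.mulVec x = 0 → x = 0)
    {I : Finset (Fin n)} (hI : (I ∪ rowSupp X).card ≤ t)
    (h : LinearMap.range (A * X).mulVecLin ≤ colSpan A I) : rowSupp X ⊆ I := by
  intro i hi
  by_contra hiI
  have hXi : X i ≠ 0 := by simpa [rowSupp] using hi
  refine hXi (funext fun j => ?_)
  obtain ⟨x, hx, hxj⟩ := mem_colSpan.1 (h ⟨Pi.single j 1, rfl⟩)
  have hzero : x - X.col j = 0 := by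
    refine hA _ ((Finset.card_le_card (vecSupp_subset fun a ha => ?_)).trans hI) ?_
    · rw [Finset.notMem_union] at ha
      simp [hx a ha.1, apply_eq_zero_of_notMem_rowSupp ha.2]
    · rw [Matrix.mulVec_sub, hxj, Matrix.mulVecLin_apply, ← Matrix.mulVec_mulVec,
        Matrix.mulVec_single_one, sub_self]
  have := congrFun hzero i
  simpa [hx i hiI] using this

theorem stmt1 {m n r s k : ℕ}
    (A : Matrix (Fin m) (Fin n) ℝ) (X : Matrix (Fin n) (Fin r) ℝ)
    (Y : Matrix (Fin m) (Fin r) ℝ) (Q : Matrix (Fin m) (Fin s) ℝ)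
    (hAX : A * X = Y)
    (hk : (rowSupp X).card = k)
    (hY : LinearIndependent ℝ (fun j : Fin r => Y.transpose j))
    (hRIP : ∀ x : Fin n → ℝ, (vecSupp x).card ≤ 2 * k - r + 1 → A.mulVec x = 0 → x = 0)
    (hQ : LinearMap.ker Q.transpose.mulVecLin = LinearMap.range Y.mulVecLin) :
    (∀ I : Finset (Fin n), k ≤ I.card → subRank Q A I = k - r → I = rowSupp X) ∧
      (∀ I : Finset (Fin n), k ≤ I.card →
        (∀ J : Finset (Fin n), k ≤ J.card → subRank Q A I ≤ subRank Q A J) →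
        I = rowSupp X) := by
  subst hAX
  have hker : Module.finrank ℝ (LinearMap.ker Q.transpose.mulVecLin) = r := by
    rw [hQ]
    simpa [Matrix.rank] using (Matrix.rank_transpose (A * X)).symm.trans hY.rank_matrix
  have hS : LinearMap.ker Q.transpose.mulVecLin ≤ colSpan A (rowSupp X) :=
    hQ.trans_le (range_mul_le_colSpan_rowSupp A X)
  have hSk : Module.finrank ℝ (colSpan A (rowSupp X)) ≤ k :=
    hk ▸ finrank_colSpan_le A (rowSupp X)
  have hrk := hker ▸ Submodule.finrank_mono hS
  have hdim (I : Finset (Fin n)) : subRank Q A I + r = Module.finrank ℝ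
      (colSpan A I ⊔ LinearMap.ker Q.transpose.mulVecLin : Submodule ℝ (Fin m → ℝ)) := by
    rw [subRank_eq, ← finrank_map_add_finrank_ker_eq_sup, hker]
  have key (I : Finset (Fin n)) (hI : k ≤ I.card) (hrank : subRank Q A I ≤ k - r) :
      I = rowSupp X := by
    have hU := hdim I
    set U := colSpan A I ⊔ LinearMap.ker Q.transpose.mulVecLin with hUdef
    have hT : colSpan A (I ∪ rowSupp X) = U ⊔ colSpan A (rowSupp X) := by
      rw [colSpan_union, hUdef, sup_assoc, sup_eq_right.2 hS]
    have hmod := Submodule.finrank_sup_add_finrank_inf_eq U (colSpan A (rowSupp X))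
    have hinf := Submodule.finrank_mono (le_inf (le_sup_right.trans hUdef.ge) hS)
    rw [hker] at hinf
    rw [← hT] at hmod
    have hcard := card_le_of_finrank_colSpan_lt hRIP (I := I ∪ rowSupp X) (by omega)
    have hIcard := finrank_colSpan_eq hRIP
      ((Finset.card_le_card Finset.subset_union_left).trans hcard)
    have hIU := Submodule.finrank_mono (le_sup_left.trans hUdef.ge : colSpan A I ≤ U)
    have hEq : colSpan A I = U :=
      Submodule.eq_of_le_of_finrank_le (le_sup_left.trans hUdef.ge) (by omega)
    have hsub : rowSupp X ⊆ I := rowSupp_subset_of_range_mul_le hRIP hcard <| by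
      rw [← hQ, hEq]
      exact le_sup_right
    exact (Finset.eq_of_subset_of_card_le hsub (by omega)).symm
  refine ⟨fun I hI h => key I hI h.le, fun I hI hmin => key I hI ?_⟩
  have hle := hmin (rowSupp X) hk.ge
  have hdimS := hdim (rowSupp X)
  rw [sup_eq_left.2 hS] at hdimS
  omega
end

section
/- Let A ∈ ℝ^{m×n}, X ∈ ℝ^{n×r}, Y ∈ ℝ^{m×r} satisfy AX = Y, where X has exactly k nonzero rows and the columns of Y are linearly independent (so rank Y = r and r ≤ k). Assume that every vector x ∈ ℝ^n with at most 2k−r+1 nonzero entries satisfying Ax = 0 is the zero vector. Let Q ∈ ℝ^{m×s} be a matrix such that the kernel of the linear map v ↦ Qᵀv equals the column space of Y. Then for every index set I ⊆ {1,…,n} with |I| = k and I ≠ supp X, one has rank(Qᵀ A_I) ≥ k − r + 1, i.e., rank(Qᵀ A_I) > k − r. -/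
open Matrix

/-- Extension by zero of a vector indexed by a finset. -/
noncomputable def extendZero {n : ℕ} (I : Finset (Fin n)) (x : I → ℝ) : Fin n → ℝ :=
  fun j => if h : j ∈ I then x ⟨j, h⟩ else 0

lemma mulVec_extendZero {m n : ℕ} (A : Matrix (Fin m) (Fin n) ℝ) (I : Finset (Fin n))
    (x : I → ℝ) :
    A *ᵥ extendZero I x = A.submatrix id (fun j : I => (j : Fin n)) *ᵥ x := by
  ext i
  simp only [mulVec, dotProduct, submatrix_apply, id]
  rw [← Finset.sum_subset (Finset.subset_univ I), ← Finset.sum_coe_sort I]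
  · simp [extendZero]
  · intro j _ hj
    simp [extendZero, hj]

lemma vecSupp_extendZero_subset {n : ℕ} (I : Finset (Fin n)) (x : I → ℝ) :
    vecSupp (extendZero I x) ⊆ I := by
  intro j hj
  by_contra h
  simp [vecSupp, extendZero, h] at hj

/-- If `X` has independent columns and row `i₀` of `X` is nonzero, some combination of the columns
of `X` is nonzero at `i₀` and vanishes at `r - 1` further indices in the row support. -/
lemma exists_mulVec_ne_zero_card_vecSupp_le {n r : ℕ} (X : Matrix (Fin n) (Fin r) ℝ)
    (hX : Function.Injective X.mulVecLin) {i₀ : Fin n} (hi₀ : X i₀ ≠ 0) :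
    ∃ c : Fin r → ℝ, (X *ᵥ c) i₀ ≠ 0 ∧ (vecSupp (X *ᵥ c)).card + r ≤ (rowSupp X).card + 1 := by
  classical
  obtain ⟨b, -, hib, hspan, hli⟩ := exists_linearIndepOn_extension (K := ℝ) (v := X.row)
    (s := {i₀}) (t := Set.univ) (LinearIndepOn.singleton hi₀) (Set.subset_univ _)
  let f : (Fin r → ℝ) →ₗ[ℝ] (b → ℝ) := (X.submatrix (fun i : b => (i : Fin n)) id).mulVecLin
  have f_apply (c : Fin r → ℝ) (i : b) : f c i = (X *ᵥ c) i := rfl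
  have hf : Function.Injective f := by
    rw [injective_iff_map_eq_zero]
    intro c hc
    apply hX
    rw [map_zero]
    ext i
    have hmem : X i ∈ Submodule.span ℝ (X.row '' b) := hspan ⟨i, trivial, rfl⟩
    change X i ⬝ᵥ c = 0
    generalize X i = v at hmem ⊢
    induction hmem using Submodule.span_induction with
    | mem x hx =>
      obtain ⟨j, hj, rfl⟩ := hx
      exact congrFun hc ⟨j, hj⟩
    | zero => simp
    | add x y _ _ hx hy => rw [add_dotProduct, hx, hy, add_zero]
    | smul a x _ hx => rw [smul_dotProduct, hx, smul_zero]
  have hle : r ≤ Fintype.card b := by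
    simpa using LinearMap.finrank_le_finrank_of_injective hf
  have hge : Fintype.card b ≤ r := by
    simpa using LinearIndependent.fintype_card_le_finrank (R := ℝ) hli
  have hsurj : Function.Surjective f :=
    (LinearMap.injective_iff_surjective_of_finrank_eq_finrank
      (by simpa using hle.antisymm hge)).1 hf
  have hi₀b : i₀ ∈ b := hib rfl
  obtain ⟨c, hc⟩ := hsurj (Pi.single ⟨i₀, hi₀b⟩ 1)
  have hc₀ : (X *ᵥ c) i₀ = 1 := by
    rw [← f_apply c ⟨i₀, hi₀b⟩, hc, Pi.single_eq_same]
  refine ⟨c, by simp [hc₀], ?_⟩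
  have hbS : b.toFinset ⊆ rowSupp X := by
    intro i hi
    have : X i ≠ 0 := hli.ne_zero (Set.mem_toFinset.1 hi)
    simpa [rowSupp] using this
  have hsub : vecSupp (X *ᵥ c) ⊆ rowSupp X \ b.toFinset.erase i₀ := by
    intro i hi
    have hi' : (X *ᵥ c) i ≠ 0 := by simpa [vecSupp] using hi
    rw [Finset.mem_sdiff]
    constructor
    · have : X i ≠ 0 := fun h => hi' (by simp [mulVec, h])
      simpa [rowSupp] using this
    · intro hmem
      rw [Finset.mem_erase, Set.mem_toFinset] at hmem
      apply hi'
      rw [← f_apply c ⟨i, hmem.2⟩, hc, Pi.single_eq_of_ne]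
      simpa using hmem.1
  have hcard := Finset.card_le_card hsub
  rw [Finset.card_sdiff_of_subset ((Finset.erase_subset _ _).trans hbS),
    Finset.card_erase_of_mem (by simpa using hi₀b), Set.toFinset_card] at hcard
  have := Finset.card_le_card hbS
  rw [Set.toFinset_card] at this
  omega

lemma card_vecSupp_sub_le {n : ℕ} (x y : Fin n → ℝ) :
    (vecSupp (x - y)).card ≤ (vecSupp x).card + (vecSupp y).card := by
  classical
  refine (Finset.card_le_card ?_).trans (Finset.card_union_le _ _)
  intro i hi
  by_contra h
  simp_all [vecSupp]

/-- If `B` is injective and `P * B` has nullity at least that of `P`, then the kernel of `P` is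
contained in the column space of `B`. -/
lemma ker_le_range_of_rank_mul_le {l m s : Type*} [Fintype l] [Fintype m] [Fintype s]
    (P : Matrix s m ℝ) (B : Matrix m l ℝ) (hB : Function.Injective B.mulVecLin)
    (h : (P * B).rank + Module.finrank ℝ (LinearMap.ker P.mulVecLin) ≤ Fintype.card l) :
    LinearMap.ker P.mulVecLin ≤ LinearMap.range B.mulVecLin := by
  have hrn := LinearMap.finrank_range_add_finrank_ker (P * B).mulVecLin
  rw [← Matrix.rank, Module.finrank_fintype_fun_eq_card] at hrn
  have hmap : (LinearMap.ker (P * B).mulVecLin).map B.mulVecLin ≤ LinearMap.ker P.mulVecLin := by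
    rintro _ ⟨x, hx, rfl⟩
    simpa using hx
  have hfin := LinearEquiv.finrank_eq (Submodule.equivMapOfInjective B.mulVecLin hB (LinearMap.ker (P * B).mulVecLin))
  rw [← Submodule.eq_of_le_of_finrank_le hmap (by omega)]
  exact LinearMap.map_le_range

theorem stmt3 {m n r s k : ℕ}
    (A : Matrix (Fin m) (Fin n) ℝ) (X : Matrix (Fin n) (Fin r) ℝ)
    (Y : Matrix (Fin m) (Fin r) ℝ) (Q : Matrix (Fin m) (Fin s) ℝ)
    (hAX : A * X = Y)
    (hk : (rowSupp X).card = k)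
    (hY : LinearIndependent ℝ (fun j : Fin r => Y.transpose j))
    (hRIP : ∀ x : Fin n → ℝ, (vecSupp x).card ≤ 2 * k - r + 1 → A.mulVec x = 0 → x = 0)
    (hQ : LinearMap.ker Q.transpose.mulVecLin = LinearMap.range Y.mulVecLin) :
    ∀ I : Finset (Fin n), I.card = k → I ≠ rowSupp X → k - r + 1 ≤ subRank Q A I := by
  intro I hI hne
  by_contra! hlt
  have hYinj : Function.Injective Y.mulVecLin := Matrix.mulVec_injective_iff.2 hY
  have hXinj : Function.Injective X.mulVecLin := by
    subst hAX
    rw [mulVecLin_mul, LinearMap.coe_comp] at hYinj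
    exact hYinj.of_comp
  obtain ⟨i₀, hi₀S, hi₀I⟩ : ∃ i ∈ rowSupp X, i ∉ I := by
    by_contra! hsub
    exact hne (Finset.eq_of_subset_of_card_le hsub (by omega)).symm
  have hi₀ : X i₀ ≠ 0 := by simpa [rowSupp] using hi₀S
  obtain ⟨c, hc₀, hc⟩ := exists_mulVec_ne_zero_card_vecSupp_le X hXinj hi₀
  have hcpos : 0 < (vecSupp (X *ᵥ c)).card :=
    Finset.card_pos.2 ⟨i₀, by simpa [vecSupp] using hc₀⟩
  have hsupp (x : I → ℝ) : (vecSupp (extendZero I x)).card ≤ k :=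
    hI ▸ Finset.card_le_card (vecSupp_extendZero_subset I x)
  let B := A.submatrix id (fun j : I => (j : Fin n))
  have hB : Function.Injective B.mulVecLin := by
    rw [injective_iff_map_eq_zero]
    intro x hx
    have h0 := hRIP (extendZero I x) ((hsupp x).trans (by omega))
      ((mulVec_extendZero A I x).trans hx)
    ext j
    simpa [extendZero] using congrFun h0 j
  have hrank : (Qᵀ * B).rank < k - r + 1 := hlt
  have hle := ker_le_range_of_rank_mul_le Qᵀ B hB (by
    rw [hQ, LinearMap.finrank_range_of_inj hYinj, Module.finrank_fintype_fun_eq_card,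
      Fintype.card_fin, Fintype.card_coe]
    omega)
  obtain ⟨x, hx⟩ := hle (hQ ▸ LinearMap.mem_range_self Y.mulVecLin c)
  have hzero := hRIP (extendZero I x - X *ᵥ c)
    ((card_vecSupp_sub_le _ _).trans (by have := hsupp x; omega)) (by
      rw [mulVec_sub, mulVec_extendZero, mulVec_mulVec, hAX, sub_eq_zero]
      exact hx)
  apply hc₀
  simpa [extendZero, hi₀I] using congrFun hzero i₀
end

section
/- Let X ∈ ℝ^{n×N} have rank r and exactly k nonzero rows. Then for every index i ∈ supp X there exists a vector w ∈ ℝ^N such that the i-th entry of Xw is nonzero and Xw has at most k − r + 1 nonzero entries. -/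
open Matrix

/-- Every nonzero row of a matrix belongs to a set of rows that is a basis of the row space. -/
theorem exists_linearIndepOn_rows_card_eq_rank {n N : ℕ} (X : Matrix (Fin n) (Fin N) ℝ)
    {i : Fin n} (hi : X i ≠ 0) :
    ∃ b : Finset (Fin n), i ∈ b ∧ LinearIndepOn ℝ X.row (b : Set (Fin n)) ∧ b.card = X.rank := by
  classical
  have hs : LinearIndepOn ℝ X.row {i} := LinearIndepOn.singleton hi
  obtain ⟨b, -, hib, hspan, hb⟩ := exists_linearIndepOn_extension hs (Set.subset_univ _)
  refine ⟨b.toFinset, by simpa using hib, by simpa using hb, ?_⟩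
  have heq : Submodule.span ℝ (Set.range X.row) = Submodule.span ℝ (X.row '' b) :=
    le_antisymm (Submodule.span_le.2 (by rwa [← Set.image_univ]))
      (Submodule.span_mono (Set.image_subset_range _ _))
  rw [Matrix.rank_eq_finrank_span_row, heq, Set.image_eq_range,
    finrank_span_eq_card hb, Set.toFinset_card]

/-- Given linearly independent rows, some vector is orthogonal to all of them but a chosen one. -/
theorem exists_mulVec_ne_zero_of_linearIndepOn {n N : ℕ} (X : Matrix (Fin n) (Fin N) ℝ)
    {i : Fin n} {b : Set (Fin n)} (hb : LinearIndepOn ℝ X.row b) (hi : i ∈ b) :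
    ∃ w : Fin N → ℝ, X.mulVec w i ≠ 0 ∧ ∀ j ∈ b, j ≠ i → X.mulVec w j = 0 := by
  have hnot : X.row i ∉ Submodule.span ℝ (X.row '' (b \ {i})) :=
    linearIndepOn_iff_notMem_span.1 hb i hi
  obtain ⟨f, hfi, hf⟩ := Submodule.exists_le_ker_of_notMem hnot
  have key : ∀ j, X.mulVec (fun l => f fun m => if l = m then 1 else 0) j = f (X.row j) := by
    intro j
    simp [LinearMap.pi_apply_eq_sum_univ f (X.row j), Matrix.mulVec, dotProduct]
  refine ⟨fun l => f fun m => if l = m then 1 else 0, by rwa [key], fun j hj hji => ?_⟩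
  rw [key]
  exact hf (Submodule.subset_span ⟨j, ⟨hj, hji⟩, rfl⟩)

theorem stmt7 {n N r k : ℕ}
    (X : Matrix (Fin n) (Fin N) ℝ)
    (hr : X.rank = r)
    (hk : (rowSupp X).card = k) :
    ∀ i ∈ rowSupp X, ∃ w : Fin N → ℝ,
      X.mulVec w i ≠ 0 ∧ (vecSupp (X.mulVec w)).card ≤ k - r + 1 := by
  classical
  intro i hi
  have hXi : X i ≠ 0 := by simpa [rowSupp] using hi
  obtain ⟨b, hib, hb, hcard⟩ := exists_linearIndepOn_rows_card_eq_rank X hXi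
  obtain ⟨w, hwi, hw⟩ := exists_mulVec_ne_zero_of_linearIndepOn X hb hib
  refine ⟨w, hwi, ?_⟩
  have hbsub : b.erase i ⊆ rowSupp X := fun j hj => by
    simpa [rowSupp, Matrix.row] using hb.ne_zero (Finset.mem_of_mem_erase hj)
  have hsub : vecSupp (X.mulVec w) ⊆ rowSupp X \ b.erase i := by
    intro j hj
    have hj' : X.mulVec w j ≠ 0 := by simpa [vecSupp] using hj
    refine Finset.mem_sdiff.2 ⟨?_, fun hjb => ?_⟩
    · simp only [rowSupp, Finset.mem_filter, Finset.mem_univ, true_and]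
      intro h0
      exact hj' (by simp [Matrix.mulVec, h0])
    · exact hj' (hw j (Finset.mem_of_mem_erase hjb) (Finset.ne_of_mem_erase hjb))
  have hle := Finset.card_le_card hsub
  rw [Finset.card_sdiff_of_subset hbsub, Finset.card_erase_of_mem hib] at hle
  omega
end

section
/- Let B ∈ ℝ^{m×k} have linearly independent columns (so BᵀB is invertible), let D = diag(d) with d_j > 0 for all j, and let λ > 0. Define the pseudoinverse B† = (BᵀB)^{-1}Bᵀ and the orthogonal projection P⊥ = I_m − B(BᵀB)^{-1}Bᵀ onto the orthogonal complement of the column space of B. Then λI_m + BDBᵀ and λ(BᵀB)^{-1} + D are invertible, and λ·(λI_m + BDBᵀ)^{-1} = P⊥ + λ·(B†)ᵀ(λ(BᵀB)^{-1} + D)^{-1}B†. -/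
open Matrix

/-- Multiplying the regularized matrix `l • 1 + B * D * Bᵀ` by the sum of the orthogonal projection
onto the complement of the column space of `B` and the compressed resolvent gives `l • 1`. -/
theorem smul_one_add_mul_projection_add_resolvent {R m k : Type*} [CommRing R]
    [Fintype m] [DecidableEq m] [Fintype k] [DecidableEq k]
    (B : Matrix m k R) (D : Matrix k k R) (l : R) (hG : IsUnit (Bᵀ * B))
    (hM : IsUnit (l • (Bᵀ * B)⁻¹ + D)) :
    (l • (1 : Matrix m m R) + B * D * Bᵀ) *
      ((1 - B * (Bᵀ * B)⁻¹ * Bᵀ) +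
        l • (((Bᵀ * B)⁻¹ * Bᵀ)ᵀ * (l • (Bᵀ * B)⁻¹ + D)⁻¹ * ((Bᵀ * B)⁻¹ * Bᵀ))) = l • 1 := by
  have hGH : Bᵀ * B * (Bᵀ * B)⁻¹ = 1 :=
    mul_nonsing_inv _ ((isUnit_iff_isUnit_det _).mp hG)
  have hMM := mul_nonsing_inv _ ((isUnit_iff_isUnit_det _).mp hM)
  have hT : ((Bᵀ * B)⁻¹ * Bᵀ)ᵀ = B * (Bᵀ * B)⁻¹ := by
    simp [transpose_nonsing_inv]
  rw [hT]
  set H := (Bᵀ * B)⁻¹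
  set M := l • H + D with hMdef
  have hP : Bᵀ * (1 - B * H * Bᵀ) = 0 := by
    rw [Matrix.mul_sub, Matrix.mul_one, ← Matrix.mul_assoc, ← Matrix.mul_assoc, hGH,
      Matrix.one_mul, sub_self]
  have hNP : (l • (1 : Matrix m m R) + B * D * Bᵀ) * (1 - B * H * Bᵀ) =
      l • (1 - B * H * Bᵀ) := by
    rw [Matrix.add_mul, Matrix.mul_assoc (B * D), hP, Matrix.mul_zero, add_zero, smul_mul,
      Matrix.one_mul]
  have hNB : (l • (1 : Matrix m m R) + B * D * Bᵀ) * (B * H) = B * M := by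
    rw [Matrix.add_mul, Matrix.mul_assoc (B * D), ← Matrix.mul_assoc Bᵀ, hGH, Matrix.mul_one,
      smul_mul, Matrix.one_mul, hMdef, Matrix.mul_add, Matrix.mul_smul]
  rw [mul_add, hNP, Matrix.mul_smul, ← Matrix.mul_assoc, ← Matrix.mul_assoc,
    ← Matrix.mul_assoc _ (B * H), hNB, Matrix.mul_assoc B M, hMM, Matrix.mul_one, ← smul_add,
    sub_add_cancel]

theorem stmt10 {m k : ℕ} (B : Matrix (Fin m) (Fin k) ℝ)
    (hB : LinearIndependent ℝ (fun j : Fin k => B.transpose j))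
    (d : Fin k → ℝ) (hd : ∀ j, 0 < d j) (lam : ℝ) (hlam : 0 < lam) :
    IsUnit (lam • (1 : Matrix (Fin m) (Fin m) ℝ) + B * Matrix.diagonal d * B.transpose) ∧
    IsUnit (lam • (B.transpose * B)⁻¹ + Matrix.diagonal d) ∧
    lam • (lam • (1 : Matrix (Fin m) (Fin m) ℝ) + B * Matrix.diagonal d * B.transpose)⁻¹ =
      (1 - B * (B.transpose * B)⁻¹ * B.transpose) +
        lam • (((B.transpose * B)⁻¹ * B.transpose).transpose *
          (lam • (B.transpose * B)⁻¹ + Matrix.diagonal d)⁻¹ *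
          ((B.transpose * B)⁻¹ * B.transpose)) := by
  have hG : (B.transpose * B).PosDef := by
    have hinj : Function.Injective B.mulVec := mulVec_injective_iff.mpr hB
    simpa using PosDef.conjTranspose_mul_self B hinj
  have hM : IsUnit (lam • (B.transpose * B)⁻¹ + Matrix.diagonal d) :=
    ((hG.inv.smul hlam).add (PosDef.diagonal hd)).isUnit
  have hN := smul_one_add_mul_projection_add_resolvent B (diagonal d) lam hG.isUnit hM
  set N := lam • (1 : Matrix (Fin m) (Fin m) ℝ) + B * Matrix.diagonal d * B.transpose
  generalize (1 - B * (B.transpose * B)⁻¹ * B.transpose) +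
        lam • (((B.transpose * B)⁻¹ * B.transpose).transpose *
          (lam • (B.transpose * B)⁻¹ + Matrix.diagonal d)⁻¹ *
          ((B.transpose * B)⁻¹ * B.transpose)) = X at hN ⊢
  have hinv : N * (lam⁻¹ • X) = 1 := by
    rw [Matrix.mul_smul, hN, inv_smul_smul₀ hlam.ne']
  refine ⟨IsUnit.of_mul_eq_one _ hinv, hM, ?_⟩
  rw [inv_eq_right_inv hinv, smul_inv_smul₀ hlam.ne']
end

section
/- Let 0 < p < 2 and q = 2p/(p−2) (so that 2/p + 2/q = 1 and q < 0). Let M ∈ ℝ^{d×d} be symmetric positive definite with eigenvalues μ_1,…,μ_d listed with multiplicity. Then the real number (2/p)·∑_{i=1}^d μ_i^{p/2} is the least element of the set of all values Tr(MΨ) − (2/q)·∑_{i=1}^d ν_i^{q/2}, where Ψ ranges over symmetric positive definite d×d real matrices with eigenvalues ν_1,…,ν_d listed with multiplicity. In particular, for every symmetric positive definite Ψ one has Tr(MΨ) − (2/q)∑_i ν_i^{q/2} ≥ (2/p)∑_i μ_i^{p/2}, and equality is attained for some positive definite Ψ (namely Ψ = M^{p/2−1} defined via the spectral decomposition of M).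 -/
open Matrix

/-- The reverse Young inequality for conjugate exponents `0 < a < 1` and `b = a / (a - 1) < 0`. -/
theorem Real.rpow_div_le_mul_sub_rpow_div {a b x y : ℝ} (ha : 0 < a) (ha1 : a < 1)
    (hb : b = a / (a - 1)) (hx : 0 < x) (hy : 0 < y) :
    x ^ a / a ≤ x * y - y ^ b / b := by
  have hne : a - 1 ≠ 0 := by linarith
  have hne' : a ≠ 0 := ha.ne'
  have hab : a + b * (1 - a) = 0 := by rw [hb]; field_simp; ring
  have key := Real.geom_mean_le_arith_mean2_weighted ha.le (by linarith : 0 ≤ 1 - a)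
    (mul_pos hx hy).le (Real.rpow_pos_of_pos hy b).le (by ring)
  rw [Real.mul_rpow hx.le hy.le, ← Real.rpow_mul hy.le, mul_assoc, ← Real.rpow_add hy, hab,
    Real.rpow_zero, mul_one] at key
  have hinv : y ^ b / b = y ^ b * (a - 1) / a := by rw [hb]; field_simp
  rw [hinv, div_le_iff₀ ha, sub_mul, div_mul_cancel₀ _ hne']
  linarith

namespace Matrix

variable {n : Type*} [Fintype n] [DecidableEq n]

theorem trace_diagonal_mul_mul_diagonal_mul_transpose (x y : n → ℝ) (W : Matrix n n ℝ) :
    (diagonal x * W * diagonal y * Wᵀ).trace = ∑ i, ∑ j, W i j ^ 2 * (x i * y j) := by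
  simp only [trace, diag_apply, mul_apply (M := diagonal x * W * diagonal y), mul_diagonal,
    diagonal_mul, transpose_apply]
  exact Finset.sum_congr rfl fun i _ => Finset.sum_congr rfl fun j _ => by ring

/-- The trace of a product of two symmetric matrices is the sum of the products of their
eigenvalues, weighted by the squared entries of an orthogonal matrix. -/
theorem IsHermitian.exists_trace_mul_eq {A B : Matrix n n ℝ} (hA : A.IsHermitian)
    (hB : B.IsHermitian) :
    ∃ W ∈ unitaryGroup n ℝ,
      (A * B).trace = ∑ i, ∑ j, W i j ^ 2 * (hA.eigenvalues i * hB.eigenvalues j) := by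
  refine ⟨_, (star hA.eigenvectorUnitary * hB.eigenvectorUnitary).2, ?_⟩
  rw [← trace_diagonal_mul_mul_diagonal_mul_transpose]
  conv_lhs => rw [hA.spectral_theorem, hB.spectral_theorem]
  simp only [Unitary.conjStarAlgAut_apply]
  rw [mul_assoc, mul_assoc, trace_mul_comm]
  simp [mul_assoc, star_eq_conjTranspose, conjTranspose_eq_transpose_of_trivial]

theorem sum_sq_row_of_mem_unitaryGroup {W : Matrix n n ℝ} (hW : W ∈ unitaryGroup n ℝ) (i : n) :
    ∑ j, W i j ^ 2 = 1 := by
  have h := congrFun (congrFun (mem_unitaryGroup_iff.mp hW) i) i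
  simpa [mul_apply, star_apply, sq] using h

theorem sum_sq_col_of_mem_unitaryGroup {W : Matrix n n ℝ} (hW : W ∈ unitaryGroup n ℝ) (j : n) :
    ∑ i, W i j ^ 2 = 1 := by
  have h := congrFun (congrFun (mem_unitaryGroup_iff'.mp hW) j) j
  simpa [mul_apply, star_apply, sq] using h

theorem IsHermitian.sum_comp_eigenvalues_of_charpoly_eq {A : Matrix n n ℝ} (hA : A.IsHermitian)
    {v : n → ℝ} (h : A.charpoly = (diagonal v).charpoly) (f : ℝ → ℝ) :
    ∑ i, f (hA.eigenvalues i) = ∑ i, f (v i) := by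
  have hroots : Finset.univ.val.map hA.eigenvalues = Finset.univ.val.map v := by
    have h₁ := hA.roots_charpoly_eq_eigenvalues
    have h₂ := Polynomial.roots_multiset_prod_X_sub_C (Finset.univ.val.map v)
    rw [Multiset.map_map] at h₂
    rw [h, charpoly_diagonal] at h₁
    exact h₁.symm.trans h₂
  have := congrArg (fun s => (s.map f).sum) hroots
  simpa [Multiset.map_map] using this

end Matrix

theorem stmt12 {d : ℕ} (p q : ℝ) (hp0 : 0 < p) (hp2 : p < 2)
    (hq : q = 2 * p / (p - 2))
    (M : Matrix (Fin d) (Fin d) ℝ) (hM : M.PosDef) :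
    IsLeast
      {x : ℝ | ∃ Ψ : Matrix (Fin d) (Fin d) ℝ, ∃ hΨ : Ψ.PosDef,
        x = (M * Ψ).trace - (2 / q) * ∑ i, (hΨ.1.eigenvalues i) ^ (q / 2)}
      ((2 / p) * ∑ i, (hM.1.eigenvalues i) ^ (p / 2)) := by
  have hp2' : p - 2 ≠ 0 := by linarith
  have hp0' : p ≠ 0 := hp0.ne'
  have hb : q / 2 = p / 2 / (p / 2 - 1) := by
    have : p / 2 - 1 = (p - 2) / 2 := by ring
    rw [hq, this]; field_simp
  have hpinv : 2 / p = 1 / (p / 2) := by field_simp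
  have hqinv : 2 / q = 1 / (q / 2) := by rw [one_div_div]
  rw [hpinv, hqinv]
  have ha : 0 < p / 2 := by linarith
  have ha1 : p / 2 < 1 := by linarith
  generalize p / 2 = a at *
  generalize q / 2 = b at *
  constructor
  · refine ⟨hM.1.cfc fun x => x ^ (a - 1), ?_, ?_⟩
    · exact (Matrix.IsUnit.posDef_star_right_conjugate_iff
        (Unitary.isUnit_coe (U := hM.1.eigenvectorUnitary))).mpr
        (PosDef.diagonal fun i => Real.rpow_pos_of_pos (hM.eigenvalues_pos i) _)
    · have hne : a - 1 ≠ 0 := by linarith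
      have htr : (M * hM.1.cfc fun x => x ^ (a - 1)).trace = ∑ i, hM.1.eigenvalues i ^ a := by
        conv_lhs => enter [1, 1]; rw [hM.1.spectral_theorem]
        rw [IsHermitian.cfc, ← map_mul, Unitary.conjStarAlgAut_apply, trace_mul_comm,
          ← mul_assoc, Unitary.coe_star_mul_self, one_mul, diagonal_mul_diagonal, trace_diagonal]
        refine Finset.sum_congr rfl fun i _ => ?_
        have := Real.rpow_add (hM.eigenvalues_pos i) 1 (a - 1)
        simpa using this.symm
      rw [htr, IsHermitian.sum_comp_eigenvalues_of_charpoly_eq (f := fun x => x ^ b)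
        (v := fun i => hM.1.eigenvalues i ^ (a - 1))]
      · have hpow (i) : (hM.1.eigenvalues i ^ (a - 1)) ^ b = hM.1.eigenvalues i ^ a := by
          rw [← Real.rpow_mul (hM.eigenvalues_pos i).le, hb, mul_div_cancel₀ _ hne]
        simp only [hpow]
        have : 1 / a = 1 - 1 / b := by rw [hb]; field_simp; ring
        rw [this]; ring
      · rw [charpoly_diagonal, ← hM.1.cfc_eq]
        exact hM.1.charpoly_cfc_eq _
  · rintro _ ⟨Ψ, hΨ, rfl⟩
    obtain ⟨W, hW, htr⟩ := hM.1.exists_trace_mul_eq hΨ.1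
    have hμ : ∑ i, hM.1.eigenvalues i ^ a / a =
        ∑ i, ∑ j, W i j ^ 2 * (hM.1.eigenvalues i ^ a / a) := by
      simp_rw [← Finset.sum_mul, sum_sq_row_of_mem_unitaryGroup hW, one_mul]
    have hν : ∑ j, hΨ.1.eigenvalues j ^ b / b =
        ∑ i, ∑ j, W i j ^ 2 * (hΨ.1.eigenvalues j ^ b / b) := by
      rw [Finset.sum_comm]
      simp_rw [← Finset.sum_mul, sum_sq_col_of_mem_unitaryGroup hW, one_mul]
    rw [one_div_mul_eq_div, one_div_mul_eq_div, Finset.sum_div, Finset.sum_div, hμ, hν, htr]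
    simp_rw [← Finset.sum_sub_distrib, ← mul_sub]
    gcongr with i _ j _
    exact Real.rpow_div_le_mul_sub_rpow_div ha ha1 hb (hM.eigenvalues_pos i)
      (hΨ.eigenvalues_pos j)
end
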